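/- Let w_1,...,w_m be positive reals and set T = (1/2)·Σ_{j=1}^m w_j. Consider m+3 goods with weights w(j) = w_j for 1 ≤ j ≤ m, w(m+1) = w(m+2) = 3T, and w(m+3) = 4T, and let μ = max over 3-partitions (P_1,P_2,P_3) of {1,...,m+3} of min_j w(P_j) be the maximin share for 3 agents. Then μ = 4T if and only if there exists a subset S ⊆ {1,...,m} with Σ_{j∈S} w_j = T. -/

import Mathlib

open Finset

/-- Weight of a bundle: sum of the weights of its goods. -/
noncomputable def setW {m : ℕ} (w : Fin m → ℝ) (S : Finset (Fin m)) : ℝ := ∑ g ∈ S, w g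

/-- An `n`-partition of the goods: pairwise disjoint parts covering everything. -/
def IsPartition {m n : ℕ} (P : Fin n → Finset (Fin m)) : Prop :=
  (∀ i j, i ≠ j → Disjoint (P i) (P j)) ∧ Finset.univ.biUnion P = Finset.univ

/-- `μ` is the maximin share. -/
def IsMaximinShare {m n : ℕ} (w : Fin m → ℝ) (μ : ℝ) : Prop :=
  (∃ P : Fin n → Finset (Fin m), IsPartition P ∧ ∀ j, μ ≤ setW w (P j)) ∧
  (∀ P : Fin n → Finset (Fin m), IsPartition P → ∃ j, setW w (P j) ≤ μ)

theorem setW_eq_sum_filter_castAdd {m : ℕ} (W : Fin (m + 3) → ℝ) (A : Finset (Fin (m + 3))) :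
    setW W A = ∑ j ∈ univ.filter (fun j : Fin m => Fin.castAdd 3 j ∈ A), W (Fin.castAdd 3 j)
      + ((if Fin.natAdd m (0 : Fin 3) ∈ A then W (Fin.natAdd m 0) else 0)
      + (if Fin.natAdd m (1 : Fin 3) ∈ A then W (Fin.natAdd m 1) else 0)
      + (if Fin.natAdd m (2 : Fin 3) ∈ A then W (Fin.natAdd m 2) else 0)) := by
  have h : setW W A = ∑ j, if j ∈ A then W j else 0 := by
    simp [setW]
  rw [h, Fin.sum_univ_add, Fin.sum_univ_three, Finset.sum_filter]

theorem IsPartition.sum_setW {m n : ℕ} {P : Fin n → Finset (Fin m)} (hP : IsPartition P)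
    (w : Fin m → ℝ) : ∑ i, setW w (P i) = ∑ j, w j := by
  rw [← hP.2, Finset.sum_biUnion fun i _ j _ hij => hP.1 i j hij]
  rfl

theorem isPartition_fiber {m n : ℕ} (c : Fin m → Fin n) :
    IsPartition fun i => univ.filter fun j => c j = i := by
  refine ⟨fun i j hij => ?_, ?_⟩
  · rw [Finset.disjoint_filter]
    rintro x - rfl
    exact hij
  · ext x
    simp

/-- in the instance built from positive reals `w₁,…,w_m` (with
`T = (1/2)·Σ w_j`, two extra goods of weight `3T` and one of weight `4T`), the maximin
share for 3 agents equals `4T` iff the `w_j` admit a subset summing to `T`. -/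
theorem stmt13 {m : ℕ} (w' : Fin m → ℝ) (hw' : ∀ j, 0 < w' j)
    (T : ℝ) (hT : T = (1 / 2) * ∑ j, w' j)
    (W : Fin (m + 3) → ℝ)
    (hW : ∀ j : Fin (m + 3), W j =
      if h : (j : ℕ) < m then w' ⟨j, h⟩
      else if (j : ℕ) = m then 3 * T
      else if (j : ℕ) = m + 1 then 3 * T
      else 4 * T)
    (μ : ℝ) (hμ : IsMaximinShare (n := 3) W μ) :
    μ = 4 * T ↔ ∃ S : Finset (Fin m), ∑ j ∈ S, w' j = T := by
  have hsmall (j : Fin m) : W (Fin.castAdd 3 j) = w' j := by simp [hW]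
  have hW0 : W (Fin.natAdd m 0) = 3 * T := by simp [hW]
  have hW1 : W (Fin.natAdd m 1) = 3 * T := by simp [hW]
  have hW2 : W (Fin.natAdd m 2) = 4 * T := by simp [hW]
  have hset (A : Finset (Fin (m + 3))) := setW_eq_sum_filter_castAdd W A
  simp only [hsmall, hW0, hW1, hW2] at hset
  have htotal : ∑ j, W j = 12 * T := by
    rw [Fin.sum_univ_add, Fin.sum_univ_three, hW0, hW1, hW2]
    simp only [hsmall]
    linarith
  obtain ⟨⟨P, hP, hPμ⟩, hmax⟩ := hμ
  have hsum := hP.sum_setW W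
  rw [htotal, Fin.sum_univ_three] at hsum
  have h0 := hPμ 0
  have h1 := hPμ 1
  have h2 := hPμ 2
  constructor
  · rintro rfl
    have hT0 : 0 ≤ T := by
      have := Finset.sum_nonneg fun j (_ : j ∈ univ) => (hw' j).le
      linarith
    rcases hT0.eq_or_lt with hz | hpos
    · exact ⟨∅, by simpa using hz⟩
    have hall : ∀ i, setW W (P i) = 4 * T := by
      intro i
      fin_cases i <;> simp only [Fin.zero_eta, Fin.mk_one, Fin.reduceFinMk] <;> linarith
    obtain ⟨i, -, hi⟩ := Finset.mem_biUnion.1 (hP.2 ▸ Finset.mem_univ (Fin.natAdd m (0 : Fin 3)))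
    refine ⟨univ.filter fun j => Fin.castAdd 3 j ∈ P i, ?_⟩
    have hi4 := hall i
    rw [hset, if_pos hi] at hi4
    have hnonneg := Finset.sum_nonneg
      fun j (_ : j ∈ univ.filter fun j => Fin.castAdd 3 j ∈ P i) => (hw' j).le
    split_ifs at hi4 <;> linarith
  · rintro ⟨S, hS⟩
    let c : Fin (m + 3) → Fin 3 := Fin.addCases (fun j => if j ∈ S then 0 else 1) id
    obtain ⟨i, hi⟩ := hmax _ (isPartition_fiber c)
    have hcompl : ∑ j with j ∉ S, w' j = T := by
      have := Finset.sum_filter_add_sum_filter_not univ (· ∈ S) w'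
      simp only [Finset.filter_univ_mem] at this
      linarith
    have hge : 4 * T ≤ μ := by
      refine le_trans (le_of_eq ?_) hi
      rw [hset]
      fin_cases i
      · simp [c, hS]
        ring
      · simp [c, hcompl]
        ring
      · have hne (j : Fin m) : (if j ∈ S then (0 : Fin 3) else 1) ≠ 2 := by
          split_ifs <;> decide
        simp [c, hne]
    linarith
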